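/- Let (X,τ) be a topological space and φ₁, φ₂ operations on X such that (φ₂(A) ⊇ φ₁(A) for all A ⊆ X, or φ₂(A) ⊇ A for all A ⊆ X) and, for each φ₁-open set U, φ₂(U) is φ₁-open and φ₂(φ₂(U)) ⊆ φ₂(U). Then a subset A of X is φ₁₂-compact if and only if every cover of A by φ₁₂-open sets has a finite subcover of A. -/

import Mathlib

open Set

/-- An operation on a topological space `X`: a map `φ : Set X → Set X` with
`interior A ⊆ φ A` for all `A` and `φ ∅ = ∅`. -/
def IsOperation {X : Type*} [TopologicalSpace X] (φ : Set X → Set X) : Prop :=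
  (∀ A : Set X, interior A ⊆ φ A) ∧ φ ∅ = ∅

/-- `A` is `φ`-open if `A ⊆ φ A`. -/
def PhiOpen {X : Type*} (φ : Set X → Set X) (A : Set X) : Prop := A ⊆ φ A

/-- `φ₁₂`-interior: `x ∈ φ₁₂int A` iff there is a `φ₁`-open `U` with `x ∈ U` and `φ₂ U ⊆ A`. -/
def PhiInt {X : Type*} (φ₁ φ₂ : Set X → Set X) (A : Set X) : Set X :=
  {x | ∃ U : Set X, PhiOpen φ₁ U ∧ x ∈ U ∧ φ₂ U ⊆ A}

/-- `φ₁₂`-closure: `x ∈ φ₁₂cl A` iff `φ₂ U ∩ A ≠ ∅` for every `φ₁`-open `U` containing `x`. -/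
def PhiCl {X : Type*} (φ₁ φ₂ : Set X → Set X) (A : Set X) : Set X :=
  {x | ∀ U : Set X, PhiOpen φ₁ U → x ∈ U → (φ₂ U ∩ A).Nonempty}

/-- `A` is `φ₁₂`-open if `A ⊆ φ₁₂int A`. -/
def Phi12Open {X : Type*} (φ₁ φ₂ : Set X → Set X) (A : Set X) : Prop :=
  A ⊆ PhiInt φ₁ φ₂ A

/-- `φ₂` is regular w.r.t. the family of `φ₁`-open sets. -/
def PhiRegular {X : Type*} (φ₂ φ₁ : Set X → Set X) : Prop :=
  ∀ x : X, ∀ U V : Set X, PhiOpen φ₁ U → PhiOpen φ₁ V → x ∈ U → x ∈ V →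
    ∃ W : Set X, PhiOpen φ₁ W ∧ x ∈ W ∧ φ₂ W ⊆ φ₂ U ∩ φ₂ V

/-- A filter `F` `φ₁₂`-converges to `a` if for every `φ₁`-open `U` containing `a`
there is `S ∈ F` with `S ⊆ φ₂ U`. -/
def PhiConv {X : Type*} (φ₁ φ₂ : Set X → Set X) (F : Filter X) (a : X) : Prop :=
  ∀ U : Set X, PhiOpen φ₁ U → a ∈ U → ∃ S ∈ F, S ⊆ φ₂ U

/-- A filter `F` `φ₁₂`-accumulates to `a` if `a ∈ φ₁₂cl S` for every `S ∈ F`. -/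
def PhiAcc {X : Type*} (φ₁ φ₂ : Set X → Set X) (F : Filter X) (a : X) : Prop :=
  ∀ S ∈ F, a ∈ PhiCl φ₁ φ₂ S

/-- `X` is `φ₁₂`-T₂. -/
def PhiT2 {X : Type*} (φ₁ φ₂ : Set X → Set X) : Prop :=
  ∀ x y : X, x ≠ y → ∃ U V : Set X, PhiOpen φ₁ U ∧ PhiOpen φ₁ V ∧
    x ∈ U ∧ y ∈ V ∧ φ₂ U ∩ φ₂ V = ∅

/-- `A` is `φ₁₂`-compact relative to `X`. -/
def PhiCompact {X : Type*} (φ₁ φ₂ : Set X → Set X) (A : Set X) : Prop :=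
  ∀ 𝒰 : Set (Set X), (∀ U ∈ 𝒰, PhiOpen φ₁ U) → A ⊆ ⋃₀ 𝒰 →
    ∃ 𝒰' ⊆ 𝒰, 𝒰'.Finite ∧ A ⊆ ⋃ U ∈ 𝒰', φ₂ U

theorem PhiOpen.subset_of_ge {X : Type*} {φ₁ φ₂ : Set X → Set X}
    (hge : (∀ A : Set X, φ₁ A ⊆ φ₂ A) ∨ (∀ A : Set X, A ⊆ φ₂ A))
    {U : Set X} (hU : PhiOpen φ₁ U) : U ⊆ φ₂ U :=
  hge.elim (fun h => hU.trans (h U)) (fun h => h U)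

theorem PhiCompact.exists_finite_subcover {X : Type*} {φ₁ φ₂ : Set X → Set X} {A : Set X}
    (hA : PhiCompact φ₁ φ₂ A) {𝒰 : Set (Set X)} (h𝒰 : ∀ U ∈ 𝒰, Phi12Open φ₁ φ₂ U)
    (hcov : A ⊆ ⋃₀ 𝒰) : ∃ 𝒰' ⊆ 𝒰, 𝒰'.Finite ∧ A ⊆ ⋃₀ 𝒰' := by
  obtain ⟨𝒱, h𝒱, hfin, hA𝒱⟩ := hA {V | PhiOpen φ₁ V ∧ ∃ U ∈ 𝒰, φ₂ V ⊆ U}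
    (fun V hV => hV.1) (fun x hx => by
      obtain ⟨U, hU, hxU⟩ := hcov hx
      obtain ⟨V, hV, hxV, hVU⟩ := h𝒰 U hU hxU
      exact ⟨V, ⟨hV, U, hU, hVU⟩, hxV⟩)
  have hsel : ∀ V : 𝒱, ∃ U ∈ 𝒰, φ₂ V ⊆ U := fun V => (h𝒱 V.2).2
  choose f hf𝒰 hf using hsel
  have : Finite 𝒱 := hfin
  refine ⟨range f, range_subset_iff.2 hf𝒰, finite_range f, fun x hx => ?_⟩
  obtain ⟨V, hV, hxV⟩ := mem_iUnion₂.1 (hA𝒱 hx)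
  exact ⟨f ⟨V, hV⟩, mem_range_self _, hf ⟨V, hV⟩ hxV⟩

/-- If (`φ₂ ≥ φ₁` or `φ₂ ≥ ι`) and for each `φ₁`-open `U`, `φ₂ U` is
`φ₁`-open with `φ₂ (φ₂ U) ⊆ φ₂ U`, then `A` is `φ₁₂`-compact iff every cover of `A` by
`φ₁₂`-open sets has a finite subcover of `A`. -/
theorem stmt_18 {X : Type*} [TopologicalSpace X] (φ₁ φ₂ : Set X → Set X)
    (h₁ : IsOperation φ₁) (h₂ : IsOperation φ₂)
    (hge : (∀ A : Set X, φ₁ A ⊆ φ₂ A) ∨ (∀ A : Set X, A ⊆ φ₂ A))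
    (hcond : ∀ U : Set X, PhiOpen φ₁ U → PhiOpen φ₁ (φ₂ U) ∧ φ₂ (φ₂ U) ⊆ φ₂ U)
    (A : Set X) :
    PhiCompact φ₁ φ₂ A ↔
      ∀ 𝒰 : Set (Set X), (∀ U ∈ 𝒰, Phi12Open φ₁ φ₂ U) → A ⊆ ⋃₀ 𝒰 →
        ∃ 𝒰' ⊆ 𝒰, 𝒰'.Finite ∧ A ⊆ ⋃₀ 𝒰' := by
  refine ⟨fun hA 𝒰 h𝒰 hcov => hA.exists_finite_subcover h𝒰 hcov, fun h 𝒰 h𝒰 hcov => ?_⟩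
  obtain ⟨𝒲, h𝒲, hfin, hA𝒲⟩ := h (φ₂ '' 𝒰)
    (by
      rintro _ ⟨U, hU, rfl⟩ x hx
      exact ⟨φ₂ U, (hcond U (h𝒰 U hU)).1, hx, (hcond U (h𝒰 U hU)).2⟩)
    (fun x hx => by
      obtain ⟨U, hU, hxU⟩ := hcov hx
      exact ⟨φ₂ U, mem_image_of_mem φ₂ hU, (h𝒰 U hU).subset_of_ge hge hxU⟩)
  obtain ⟨𝒰', h𝒰', hfin', rfl⟩ := hfin.exists_subset_finite_image_eq h𝒲
  exact ⟨𝒰', h𝒰', hfin', by rwa [sUnion_image] at hA𝒲⟩
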